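/- [Disjoint tops claim] There exist absolute constants C, c > 0 such that the following holds for every w > 0, every measurable F ⊆ ℝ², and every σ > 0. Let 𝒯 be a finite collection of pairwise disjoint trees such that: (i) all tops satisfy top(T) ≤ R for a single tile R; (ii) size(⋃_{T∈𝒯} T) ≤ σ; and (iii) each T ∈ 𝒯 satisfies Σ_{s∈T₁}|⟨1_F, φ_s⟩|² ≥ c·σ²·|top(T)|, where T₁ is the maximal 1-subtree of T. Then there is a subcollection 𝒯' ⊆ 𝒯 such that the tops {top(T) : T ∈ 𝒯'} are pairwise disjoint sets and Σ_{T∈𝒯}|top(T)| ≤ C·Σ_{T∈𝒯'}|top(T)|. -/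

import Mathlib

open MeasureTheory Set Filter
open scoped Classical

noncomputable section

namespace Bateman

/-- A tile: frequency scale `l` (the frequency interval has length `2^{-l}`), frequency
position `m` (the interval is `[m·2^{-l}, (m+1)·2^{-l})`, contained in `[-2,2]`),
spatial dyadic position `n` (the `x`-projection is `[n·w·2^l, (n+1)·w·2^l)`) and
vertical position `k`. -/
structure Tile where
  l : ℕ
  m : ℤ
  n : ℤ
  k : ℤ
  hlo : (-2 : ℝ) ≤ (m : ℝ) * (2:ℝ) ^ (-(l:ℤ))
  hhi : ((m : ℝ) + 1) * (2:ℝ) ^ (-(l:ℤ)) ≤ 2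

noncomputable instance : DecidableEq Tile := Classical.decEq _

namespace Tile

/-- Length of the frequency interval of a tile. -/
def freqLen (s : Tile) : ℝ := (2:ℝ) ^ (-(s.l:ℤ))

/-- Frequency interval `ω_s`. -/
def ω (s : Tile) : Set ℝ := Ico ((s.m : ℝ) * s.freqLen) (((s.m : ℝ) + 1) * s.freqLen)

/-- Center of `ω_s`; this is the slope of the long side of the tile. -/
def slope (s : Tile) : ℝ := ((s.m : ℝ) + 1/2) * s.freqLen

/-- Right half `ω_{s,1}` of `ω_s`. -/
def ω1 (s : Tile) : Set ℝ := Ico s.slope (((s.m : ℝ) + 1) * s.freqLen)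

/-- Left half `ω_{s,2}` of `ω_s`. -/
def ω2 (s : Tile) : Set ℝ := Ico ((s.m : ℝ) * s.freqLen) s.slope

/-- Length `L(s) = w·2^l` of the tile. -/
def len (w : ℝ) (s : Tile) : ℝ := w * 2 ^ s.l

/-- The spatial parallelogram of the tile: two vertical sides of length `w`, two long
sides of slope `c(ω_s)` and length `w·2^l`, `x`-projection a dyadic interval. -/
def rect (w : ℝ) (s : Tile) : Set (ℝ × ℝ) :=
  {p | p.1 ∈ Ico ((s.n : ℝ) * s.len w) (((s.n : ℝ) + 1) * s.len w) ∧
       p.2 - s.slope * p.1 ∈ Ico ((s.k : ℝ) * w) (((s.k : ℝ) + 1) * w)}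

/-- Area `|s| = w²·2^l` of the tile. -/
def area (w : ℝ) (s : Tile) : ℝ := w ^ 2 * 2 ^ s.l

/-- Center of the tile. -/
def center (w : ℝ) (s : Tile) : ℝ × ℝ :=
  (((s.n : ℝ) + 1/2) * s.len w,
   s.slope * (((s.n : ℝ) + 1/2) * s.len w) + ((s.k : ℝ) + 1/2) * w)

/-- Dilate `C·s` of the tile by a factor `C` about its center. -/
def dilate (w C : ℝ) (s : Tile) : Set (ℝ × ℝ) :=
  (fun p => s.center w + C • (p - s.center w)) '' s.rect w

/-- Order on tiles: `s ≤ s'` iff `s ⊆ 10·s'` and `ω_{s'} ⊆ ω_s`. -/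
def le (w : ℝ) (s s' : Tile) : Prop := s.rect w ⊆ s'.dilate w 10 ∧ s'.ω ⊆ s.ω

/-- The affine map taking the tile onto the unit square centered at the origin. -/
def unitMap (w : ℝ) (s : Tile) (p : ℝ × ℝ) : ℝ × ℝ :=
  ((p.1 - ((s.n : ℝ) + 1/2) * s.len w) / s.len w,
   (p.2 - s.slope * p.1 - ((s.k : ℝ) + 1/2) * w) / w)

end Tile

/-- The weight `χ(x) = (1 + |x|^{100})⁻¹` on `ℝ²`. -/
def chi (p : ℝ × ℝ) : ℝ := (1 + (p.1 ^ 2 + p.2 ^ 2) ^ (50:ℕ))⁻¹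

/-- `χ_s^{(1)} = |s|⁻¹·χ∘A_s`, the `L¹`-normalized version of `χ` adapted to the tile. -/
def chi1 (w : ℝ) (s : Tile) (p : ℝ × ℝ) : ℝ := (s.area w)⁻¹ * chi (s.unitMap w p)

/-- The density `dense(s) = ∫_{E_s} χ_s^{(1)}` where `E_s = {(x,y) ∈ E : u(x) ∈ ω_s}`. -/
def dens (w : ℝ) (u : ℝ → ℝ) (E : Set (ℝ × ℝ)) (s : Tile) : ℝ :=
  ∫ p in {p ∈ E | u p.1 ∈ s.ω}, chi1 w s p

/-- The upward density `udense(s) = sup{dense(s') : s ≤ s'}`. -/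
def udens (w : ℝ) (u : ℝ → ℝ) (E : Set (ℝ × ℝ)) (s : Tile) : ℝ :=
  sSup {x | ∃ s' : Tile, Tile.le w s s' ∧ x = dens w u E s'}

/-- `e(t) = exp(2πit)`. -/
def e (t : ℝ) : ℂ := Complex.exp (Complex.I * ((2 * Real.pi * t : ℝ) : ℂ))

/-- The multiplier `m̂_ω(ξ,η) = β̃(wη)·β_ω(ξ/η)` of a tile, where
`β_ω(x) = β(2^{l+c}(x − c(ω₁)))` and `c(ω₁) = (m + 3/4)·2^{-l}` is the center of the
right half of `ω`. -/
def mhat (β βt : ℝ → ℝ) (cc : ℕ) (w : ℝ) (s : Tile) (ξ : ℝ × ℝ) : ℝ :=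
  βt (w * ξ.2) * β ((2:ℝ) ^ (s.l + cc) * (ξ.1 / ξ.2 - ((s.m : ℝ) + 3/4) * s.freqLen))

/-- `φ_ω`, the inverse Fourier transform of `(m̂_ω)^{1/2}`. -/
def φω (β βt : ℝ → ℝ) (cc : ℕ) (w : ℝ) (s : Tile) (x : ℝ × ℝ) : ℂ :=
  ∫ ξ : ℝ × ℝ, e (x.1 * ξ.1 + x.2 * ξ.2) * ((Real.sqrt (mhat β βt cc w s ξ) : ℝ) : ℂ)

/-- The `L²`-normalized wave packet `φ_s(p) = |s|^{1/2}·φ_ω(p − c(s))`. -/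
def wp (β βt : ℝ → ℝ) (cc : ℕ) (w : ℝ) (s : Tile) (p : ℝ × ℝ) : ℂ :=
  ((Real.sqrt (s.area w) : ℝ) : ℂ) * φω β βt cc w s (p - s.center w)

/-- `⟨f,g⟩ = ∫ f·conj g`. -/
def inn (f g : ℝ × ℝ → ℂ) : ℂ := ∫ p : ℝ × ℝ, f p * (starRingEnd ℂ) (g p)

/-- The inverse Fourier transform of `ψ_s(θ) = ψ(L(s)·θ)`. -/
def psiCheck (ψ : ℝ → ℝ) (w : ℝ) (s : Tile) (t : ℝ) : ℂ :=
  ∫ θ : ℝ, e (t * θ) * ((ψ (s.len w * θ) : ℝ) : ℂ)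

/-- The transformed wave packet
`phi_s(x₁,x₂) = ∫ ψ̌_s(t)·φ_s(x₁ − t, x₂ − t·u(x₁)) dt`. -/
def phiT (β βt ψ : ℝ → ℝ) (cc : ℕ) (w : ℝ) (u : ℝ → ℝ) (s : Tile) (x : ℝ × ℝ) : ℂ :=
  ∫ t : ℝ, psiCheck ψ w s t * wp β βt cc w s (x.1 - t, x.2 - t * u x.1)

/-- Hypotheses on the bump function `β`: smooth, `[0,1]`-valued, `1` on `[-1,1]`,
vanishing outside `[-2,2]`, with smooth square root. -/
def IsBumpβ (β : ℝ → ℝ) : Prop :=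
  ContDiff ℝ (⊤ : ℕ∞) β ∧ (∀ x, β x ∈ Icc (0:ℝ) 1) ∧ (∀ x ∈ Icc (-1:ℝ) 1, β x = 1) ∧
  (∀ x : ℝ, 2 ≤ |x| → β x = 0) ∧ ContDiff ℝ (⊤ : ℕ∞) (fun x => Real.sqrt (β x))

/-- Hypotheses on the bump function `β̃`: smooth, `[0,1]`-valued, supported in
`[1/2,5/2]` and equal to `1` on `[1,2]`. -/
def IsBumpβt (βt : ℝ → ℝ) : Prop :=
  ContDiff ℝ (⊤ : ℕ∞) βt ∧ (∀ x, βt x ∈ Icc (0:ℝ) 1) ∧ (∀ x ∈ Icc (1:ℝ) 2, βt x = 1) ∧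
  (∀ x : ℝ, x ∉ Icc (1/2 : ℝ) (5/2) → βt x = 0)

/-- Hypotheses on the bump function `ψ`: smooth, `[0,1]`-valued, supported in
`[98/100, 102/100]` and equal to `1` on `[99/100, 101/100]`. -/
def IsBumpψ (ψ : ℝ → ℝ) : Prop :=
  ContDiff ℝ (⊤ : ℕ∞) ψ ∧ (∀ x, ψ x ∈ Icc (0:ℝ) 1) ∧
  (∀ x ∈ Icc (99/100 : ℝ) (101/100), ψ x = 1) ∧
  (∀ x : ℝ, x ∉ Icc (98/100 : ℝ) (102/100) → ψ x = 0)

/-- A tree: a finite set of tiles together with a top tile. -/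
structure Tree where
  tiles : Finset Tile
  top : Tile

/-- `T` is a tree: every tile of `T` lies below the top. -/
def Tree.IsTree (w : ℝ) (T : Tree) : Prop := ∀ s ∈ T.tiles, Tile.le w s T.top

/-- `T` is a `1`-tree: moreover `ω_{top(T)} ∩ ω_{s,1} = ∅` for all `s ∈ T`. -/
def Tree.IsOneTree (w : ℝ) (T : Tree) : Prop :=
  T.IsTree w ∧ ∀ s ∈ T.tiles, T.top.ω ∩ s.ω1 = ∅

/-- The maximal `1`-subtree `T₁` of a tree `T`. -/
def Tree.oneTiles (T : Tree) : Finset Tile :=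
  T.tiles.filter fun s => T.top.ω ∩ s.ω1 = ∅

/-- `(1/|top(T)|)·Σ_{s∈T}|⟨f,φ_s⟩|²`. -/
def energy (β βt : ℝ → ℝ) (cc : ℕ) (w : ℝ) (f : ℝ × ℝ → ℂ) (T : Tree) : ℝ :=
  (T.top.area w)⁻¹ * ∑ s ∈ T.tiles, ‖inn f (wp β βt cc w s)‖ ^ 2

/-- The size of a finite collection of tiles with respect to the set `F`:
the supremum over `1`-trees `T ⊆ S` of `(|top(T)|⁻¹·Σ_{s∈T}|⟨1_F,φ_s⟩|²)^{1/2}`. -/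
def size (β βt : ℝ → ℝ) (cc : ℕ) (w : ℝ) (F : Set (ℝ × ℝ)) (S : Finset Tile) : ℝ :=
  sSup (insert 0 {x | ∃ T : Tree, T.IsOneTree w ∧ T.tiles ⊆ S ∧
    x = Real.sqrt (energy β βt cc w (F.indicator fun _ => (1:ℂ)) T)})


namespace Tile

lemma freqLen_pos (s : Tile) : 0 < s.freqLen := by unfold freqLen; positivity

lemma freqLen_mul_two_pow (s : Tile) : s.freqLen * 2 ^ s.l = 1 := by
  unfold freqLen
  rw [zpow_neg, zpow_natCast, inv_mul_cancel₀ (by positivity)]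

lemma len_pos {w : ℝ} (hw : 0 < w) (s : Tile) : 0 < s.len w := by unfold len; positivity

lemma area_pos {w : ℝ} (hw : 0 < w) (s : Tile) : 0 < s.area w := by unfold area; positivity

lemma len_le_len {w : ℝ} (hw : 0 < w) {s t : Tile} (h : s.l ≤ t.l) : s.len w ≤ t.len w :=
  mul_le_mul_of_nonneg_left (pow_le_pow_right₀ (by norm_num) h) hw.le

lemma slope_mem_ω (s : Tile) : s.slope ∈ s.ω := by
  have := s.freqLen_pos
  constructor <;> unfold slope <;> nlinarith

lemma abs_sub_slope_le {s : Tile} {x : ℝ} (hx : x ∈ s.ω) : |x - s.slope| ≤ s.freqLen / 2 := by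
  obtain ⟨h₁, h₂⟩ := hx
  unfold slope
  rw [abs_le]
  constructor <;> nlinarith

lemma mem_ω_iff {s : Tile} {x : ℝ} :
    x ∈ s.ω ↔ (s.m : ℝ) ≤ x * 2 ^ s.l ∧ x * 2 ^ s.l < s.m + 1 := by
  have h : (0 : ℝ) < 2 ^ s.l := by positivity
  have e₁ : s.freqLen = 1 / 2 ^ s.l := (eq_div_iff h.ne').2 s.freqLen_mul_two_pow
  rw [ω, mem_Ico, e₁, mul_one_div, mul_one_div, div_le_iff₀ h, lt_div_iff₀ h]

/-- Dyadic intervals which meet are nested. -/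
lemma ω_subset_ω {s t : Tile} (hl : s.l ≤ t.l) {x : ℝ} (hs : x ∈ s.ω) (ht : x ∈ t.ω) :
    t.ω ⊆ s.ω := by
  obtain ⟨d, hd⟩ := Nat.exists_eq_add_of_le hl
  rw [mem_ω_iff] at hs ht
  have hpos : (0 : ℝ) < 2 ^ d := by positivity
  rw [hd, pow_add, ← mul_assoc] at ht
  have h₁ : s.m * 2 ^ d < t.m + 1 := by
    have : (s.m : ℝ) * 2 ^ d < t.m + 1 := by nlinarith
    exact_mod_cast this
  have h₂ : t.m < (s.m + 1) * 2 ^ d := by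
    have : (t.m : ℝ) < (s.m + 1) * 2 ^ d := by nlinarith
    exact_mod_cast this
  have h₁' : (s.m : ℝ) * 2 ^ d ≤ t.m := by exact_mod_cast Int.lt_add_one_iff.1 h₁
  have h₂' : (t.m : ℝ) + 1 ≤ (s.m + 1) * 2 ^ d := by exact_mod_cast h₂
  intro y hy
  rw [mem_ω_iff] at hy ⊢
  rw [hd, pow_add, ← mul_assoc] at hy
  exact ⟨le_of_mul_le_mul_right (h₁'.trans hy.1) hpos,
    lt_of_mul_lt_mul_right (hy.2.trans_le h₂') hpos.le⟩

lemma l_le_of_ω_subset {s t : Tile} (h : t.ω ⊆ s.ω) : s.l ≤ t.l := by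
  by_contra! hl
  have hx := t.slope_mem_ω
  have hst : s.ω = t.ω := (ω_subset_ω hl.le hx (h hx)).antisymm h
  have hlt : s.freqLen < t.freqLen := by
    unfold freqLen
    exact zpow_lt_zpow_right₀ (by norm_num) (by omega)
  have hs := s.freqLen_pos
  have hm : (s.m : ℝ) * s.freqLen = t.m * t.freqLen := by
    refine le_antisymm ?_ ?_
    · exact (h ⟨le_rfl, by nlinarith⟩ : (t.m : ℝ) * t.freqLen ∈ s.ω).1
    · exact (hst.le ⟨le_rfl, by nlinarith⟩ : (s.m : ℝ) * s.freqLen ∈ t.ω).1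
  have hmem : (s.m + 1 : ℝ) * s.freqLen ∈ t.ω := ⟨by nlinarith, by nlinarith⟩
  exact lt_irrefl _ (h hmem).2

lemma rect_nonempty {w : ℝ} (hw : 0 < w) (s : Tile) : (s.rect w).Nonempty := by
  have := s.len_pos hw
  refine ⟨(s.n * s.len w, s.k * w + s.slope * (s.n * s.len w)), ⟨le_rfl, ?_⟩, ?_, ?_⟩ <;>
    dsimp only <;> nlinarith

lemma abs_le_of_mem_dilate_ten {w : ℝ} {s : Tile} {p : ℝ × ℝ} (hp : p ∈ s.dilate w 10) :
    |p.1 - (s.center w).1| ≤ 5 * s.len w ∧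
    |p.2 - (s.center w).2 - s.slope * (p.1 - (s.center w).1)| ≤ 5 * w := by
  obtain ⟨q, ⟨⟨h₁, h₂⟩, h₃, h₄⟩, rfl⟩ := hp
  simp only [center, Prod.fst_add, Prod.snd_add, Prod.smul_fst, Prod.smul_snd, Prod.fst_sub,
    Prod.snd_sub, smul_eq_mul]
  refine ⟨abs_le.2 ⟨?_, ?_⟩, abs_le.2 ⟨?_, ?_⟩⟩ <;> nlinarith

lemma mem_dilate_ten {w : ℝ} {s : Tile} {p : ℝ × ℝ}
    (h₁ : |p.1 - (s.center w).1| < 5 * s.len w)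
    (h₂ : |p.2 - (s.center w).2 - s.slope * (p.1 - (s.center w).1)| < 5 * w) :
    p ∈ s.dilate w 10 := by
  rw [abs_lt] at h₁ h₂
  refine ⟨s.center w + (1 / 10 : ℝ) • (p - s.center w), ⟨?_, ?_⟩, ?_⟩
  · simp only [center, Prod.fst_add, Prod.smul_fst, Prod.fst_sub, smul_eq_mul] at h₁ ⊢
    constructor <;> linarith
  · simp only [center, Prod.fst_add, Prod.snd_add, Prod.smul_fst, Prod.smul_snd, Prod.fst_sub,
      Prod.snd_sub, smul_eq_mul] at h₂ ⊢
    constructor <;> linarith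
  · simp [smul_smul]

lemma abs_le_of_mem_rect {w : ℝ} {s : Tile} {p : ℝ × ℝ} (hp : p ∈ s.rect w) :
    |p.1 - (s.center w).1| ≤ s.len w / 2 ∧
    |p.2 - (s.center w).2 - s.slope * (p.1 - (s.center w).1)| ≤ w / 2 := by
  obtain ⟨⟨h₁, h₂⟩, h₃, h₄⟩ := hp
  simp only [center]
  refine ⟨abs_le.2 ⟨?_, ?_⟩, abs_le.2 ⟨?_, ?_⟩⟩ <;> linarith

/-- Changing the slope from one tile to a finer frequency costs a bounded multiple of `w`. -/
lemma abs_slope_sub_mul_le {w : ℝ} {s t : Tile} (h : t.ω ⊆ s.ω) {x K : ℝ}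
    (hx : |x| ≤ K * s.len w) : |(t.slope - s.slope) * x| ≤ K * w / 2 := by
  rw [abs_mul]
  calc |t.slope - s.slope| * |x| ≤ s.freqLen / 2 * (K * s.len w) :=
        mul_le_mul (abs_sub_slope_le (h t.slope_mem_ω)) hx (abs_nonneg _)
          (by have := s.freqLen_pos; positivity)
    _ = K * w / 2 * (s.freqLen * 2 ^ s.l) := by unfold len; ring
    _ = K * w / 2 := by rw [freqLen_mul_two_pow, mul_one]

/-- The tile of the same frequency interval, moved by `ij.1` steps horizontally and
`ij.2` steps vertically. -/
def translate (t : Tile) (ij : ℤ × ℤ) : Tile := { t with n := t.n + ij.1, k := t.k + ij.2 }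

lemma subset_dilate_ten_of_mem {w : ℝ} (hw : 0 < w) {s t : Tile} (h : t.ω ⊆ s.ω) {q : ℝ × ℝ}
    (hqs : q ∈ s.rect w) (hqt : q ∈ t.rect w) : s.rect w ⊆ t.dilate w 10 := by
  intro p hp
  have hlen := len_le_len hw (l_le_of_ω_subset h)
  have hpos := s.len_pos hw
  obtain ⟨a₁, a₂⟩ := abs_le_of_mem_rect hp
  obtain ⟨b₁, b₂⟩ := abs_le_of_mem_rect hqs
  obtain ⟨c₁, c₂⟩ := abs_le_of_mem_rect hqt
  have hx : |p.1 - q.1| ≤ 1 * s.len w := by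
    rw [abs_le] at *; constructor <;> linarith
  have hv := abs_slope_sub_mul_le h hx
  rw [abs_le] at *
  refine mem_dilate_ten (abs_lt.2 ⟨?_, ?_⟩) (abs_lt.2 ⟨?_, ?_⟩) <;> linarith

/-- If the tops `a` and `b` meet and `b` is the longer one, every tile below `a` lies below one
of boundedly many translates of `b`. -/
lemma exists_le_translate {w : ℝ} (hw : 0 < w) {s a b : Tile} (hs : s.le w a) (hab : b.ω ⊆ a.ω)
    (hmeet : (a.rect w ∩ b.rect w).Nonempty) :
    ∃ ij ∈ Finset.Icc (-10 : ℤ) 10 ×ˢ Finset.Icc (-10 : ℤ) 10, s.le w (b.translate ij) := by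
  obtain ⟨q, hqa, hqb⟩ := hmeet
  obtain ⟨p, hp⟩ := s.rect_nonempty hw
  have hlen := len_le_len hw (l_le_of_ω_subset hab)
  have hpos := b.len_pos hw
  obtain ⟨a₁, a₂⟩ := abs_le_of_mem_dilate_ten (hs.1 hp)
  obtain ⟨b₁, b₂⟩ := abs_le_of_mem_rect hqa
  have hx : |p.1 - q.1| ≤ 6 * a.len w := by
    have := a.len_pos hw
    rw [abs_le] at *; constructor <;> linarith
  have hv := abs_slope_sub_mul_le hab hx
  obtain ⟨⟨c₁, c₂⟩, c₃, c₄⟩ := hqb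
  rw [abs_le] at *
  set N := ⌊p.1 / b.len w⌋ with hN
  set K := ⌊(p.2 - b.slope * p.1) / w⌋ with hK
  have hN₁ : (N : ℝ) * b.len w ≤ p.1 := (le_div_iff₀ hpos).1 (Int.floor_le _)
  have hN₂ : p.1 < ((N : ℝ) + 1) * b.len w := (div_lt_iff₀ hpos).1 (Int.lt_floor_add_one _)
  have hK₁ : (K : ℝ) * w ≤ p.2 - b.slope * p.1 := (le_div_iff₀ hw).1 (Int.floor_le _)
  have hK₂ : p.2 - b.slope * p.1 < ((K : ℝ) + 1) * w :=
    (div_lt_iff₀ hw).1 (Int.lt_floor_add_one _)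
  refine ⟨(N - b.n, K - b.k), ?_, ?_, hab.trans hs.2⟩
  · have n₁ : (-8 : ℝ) < N - b.n := lt_of_mul_lt_mul_right (by linarith) hpos.le
    have n₂ : (N - b.n : ℝ) < 8 := lt_of_mul_lt_mul_right (by linarith) hpos.le
    have k₁ : (-11 : ℝ) < K - b.k := lt_of_mul_lt_mul_right (by linarith) hw.le
    have k₂ : (K - b.k : ℝ) < 11 := lt_of_mul_lt_mul_right (by linarith) hw.le
    have n₁' : -8 < N - b.n := by exact_mod_cast n₁
    have n₂' : N - b.n < 8 := by exact_mod_cast n₂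
    have k₁' : -11 < K - b.k := by exact_mod_cast k₁
    have k₂' : K - b.k < 11 := by exact_mod_cast k₂
    simp only [Finset.mem_product, Finset.mem_Icc]
    omega
  · refine subset_dilate_ten_of_mem hw (show (b.translate (N - b.n, K - b.k)).ω ⊆ s.ω from
      hab.trans hs.2) hp ⟨?_, ?_⟩
    · change p.1 ∈ Ico (((b.n + (N - b.n) : ℤ) : ℝ) * b.len w)
        ((((b.n + (N - b.n) : ℤ) : ℝ) + 1) * b.len w)
      rw [add_sub_cancel]
      exact ⟨hN₁, hN₂⟩
    · change p.2 - b.slope * p.1 ∈ Ico (((b.k + (K - b.k) : ℤ) : ℝ) * w)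
        ((((b.k + (K - b.k) : ℤ) : ℝ) + 1) * w)
      rw [add_sub_cancel]
      exact ⟨hK₁, hK₂⟩

end Tile

lemma bddAbove_size (β βt : ℝ → ℝ) (cc : ℕ) {w : ℝ} (hw : 0 < w) (F : Set (ℝ × ℝ))
    (S : Finset Tile) :
    BddAbove (insert 0 {x | ∃ T : Tree, T.IsOneTree w ∧ T.tiles ⊆ S ∧
      x = Real.sqrt (energy β βt cc w (F.indicator fun _ => (1:ℂ)) T)}) := by
  refine BddAbove.insert 0 ⟨Real.sqrt ((w ^ 2)⁻¹ * ∑ s ∈ S,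
    ‖inn (F.indicator fun _ => (1:ℂ)) (wp β βt cc w s)‖ ^ 2), ?_⟩
  rintro _ ⟨T, -, hTS, rfl⟩
  refine Real.sqrt_le_sqrt (mul_le_mul ?_ ?_ (by positivity) (by positivity))
  · exact inv_anti₀ (by positivity)
      (le_mul_of_one_le_right (by positivity) (one_le_pow₀ (by norm_num)))
  · exact Finset.sum_le_sum_of_subset_of_nonneg hTS fun _ _ _ => by positivity

lemma Tree.IsOneTree.sum_le {β βt : ℝ → ℝ} {cc : ℕ} {w : ℝ} (hw : 0 < w) {F : Set (ℝ × ℝ)}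
    {S : Finset Tile} {σ : ℝ} (hσ : 0 ≤ σ) (hS : size β βt cc w F S ≤ σ) {T : Tree}
    (hT : T.IsOneTree w) (hTS : T.tiles ⊆ S) :
    ∑ s ∈ T.tiles, ‖inn (F.indicator fun _ => (1:ℂ)) (wp β βt cc w s)‖ ^ 2
      ≤ σ ^ 2 * T.top.area w := by
  have h := (le_csSup (bddAbove_size β βt cc hw F S) (Or.inr ⟨T, hT, hTS, rfl⟩)).trans hS
  rw [Real.sqrt_le_left hσ, energy, inv_mul_le_iff₀ (T.top.area_pos hw)] at h
  linarith

/-- The trees whose tops meet a fixed longer top have total top area controlled by it. -/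
lemma sum_area_le_of_meet {β βt : ℝ → ℝ} {cc : ℕ} {w : ℝ} (hw : 0 < w) {F : Set (ℝ × ℝ)}
    {σ c : ℝ} (hσ : 0 < σ) (hc : 0 < c) {S : Finset Tile} (hS : size β βt cc w F S ≤ σ)
    {𝒜 : Finset Tree} {b : Tile} (hsub : ∀ T ∈ 𝒜, T.tiles ⊆ S) (htree : ∀ T ∈ 𝒜, T.IsTree w)
    (hω : ∀ T ∈ 𝒜, b.ω ⊆ T.top.ω) (hmeet : ∀ T ∈ 𝒜, (T.top.rect w ∩ b.rect w).Nonempty)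
    (hdisj : ∀ T ∈ 𝒜, ∀ T' ∈ 𝒜, T ≠ T' → Disjoint T.tiles T'.tiles)
    (hlow : ∀ T ∈ 𝒜, c * σ ^ 2 * T.top.area w ≤
      ∑ s ∈ T.oneTiles, ‖inn (F.indicator fun _ => (1:ℂ)) (wp β βt cc w s)‖ ^ 2) :
    ∑ T ∈ 𝒜, T.top.area w ≤ 441 / c * b.area w := by
  set f : Tile → ℝ := fun s => ‖inn (F.indicator fun _ => (1:ℂ)) (wp β βt cc w s)‖ ^ 2
  set I := Finset.Icc (-10 : ℤ) 10 ×ˢ Finset.Icc (-10 : ℤ) 10 with hI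
  set U : Finset Tile := 𝒜.biUnion Tree.oneTiles
  have hUω : ∀ s ∈ U, b.ω ∩ s.ω1 = ∅ := by
    intro s hs
    obtain ⟨T, hT, hs⟩ := Finset.mem_biUnion.1 hs
    exact subset_empty_iff.1 ((inter_subset_inter_left _ (hω T hT)).trans
      (Finset.mem_filter.1 hs).2.subset)
  have hUS : U ⊆ S := Finset.biUnion_subset.2 fun T hT =>
    (Finset.filter_subset _ _).trans (hsub T hT)
  have hcover : ∀ s ∈ U, ∃ ij ∈ I, s.le w (b.translate ij) := by
    intro s hs
    obtain ⟨T, hT, hsT⟩ := Finset.mem_biUnion.1 hs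
    exact Tile.exists_le_translate hw (htree T hT s (Finset.mem_filter.1 hsT).1) (hω T hT)
      (hmeet T hT)
  choose! g hgI hgle using hcover
  have hone : ∀ ij ∈ I, ∑ s ∈ U.filter (fun s => g s = ij), f s ≤ σ ^ 2 * b.area w :=
    fun ij _ => Tree.IsOneTree.sum_le hw hσ.le hS
      (T := ⟨U.filter fun s => g s = ij, b.translate ij⟩)
      ⟨fun s hs => (Finset.mem_filter.1 hs).2 ▸ hgle s (Finset.mem_filter.1 hs).1,
        fun s hs => hUω s (Finset.mem_filter.1 hs).1⟩
      ((Finset.filter_subset _ _).trans hUS)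
  have hsum : c * σ ^ 2 * ∑ T ∈ 𝒜, T.top.area w ≤ 441 * (σ ^ 2 * b.area w) := calc
    c * σ ^ 2 * ∑ T ∈ 𝒜, T.top.area w
      = ∑ T ∈ 𝒜, c * σ ^ 2 * T.top.area w := Finset.mul_sum _ _ _
    _ ≤ ∑ T ∈ 𝒜, ∑ s ∈ T.oneTiles, f s := Finset.sum_le_sum hlow
    _ = ∑ s ∈ U, f s := (Finset.sum_biUnion fun T hT T' hT' hne =>
        (hdisj T hT T' hT' hne).mono (Finset.filter_subset _ _) (Finset.filter_subset _ _)).symm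
    _ = ∑ ij ∈ I, ∑ s ∈ U.filter (fun s => g s = ij), f s :=
        (Finset.sum_fiberwise_of_maps_to hgI _).symm
    _ ≤ ∑ ij ∈ I, σ ^ 2 * b.area w := Finset.sum_le_sum hone
    _ = 441 * (σ ^ 2 * b.area w) := by simp [hI]
  have hσ2 : 0 < σ ^ 2 := by positivity
  rw [div_mul_eq_mul_div, le_div_iff₀ hc]
  exact le_of_mul_le_mul_right (by linarith) hσ2

/-- The selection of disjoint tops, for an arbitrary lower constant `c`. -/
lemma exists_disjoint_tops {β βt : ℝ → ℝ} {cc : ℕ} {w : ℝ} (hw : 0 < w) {F : Set (ℝ × ℝ)}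
    {σ c : ℝ} (hσ : 0 < σ) (hc : 0 < c) {R : Tile} {𝒯 : Finset Tree}
    (htree : ∀ T ∈ 𝒯, T.IsTree w ∧ Tile.le w T.top R)
    (hdisj : ∀ T ∈ 𝒯, ∀ T' ∈ 𝒯, T ≠ T' → Disjoint T.tiles T'.tiles)
    (hsize : size β βt cc w F (𝒯.sup Tree.tiles) ≤ σ)
    (hlow : ∀ T ∈ 𝒯, c * σ ^ 2 * T.top.area w ≤
      ∑ s ∈ T.oneTiles, ‖inn (F.indicator fun _ => (1:ℂ)) (wp β βt cc w s)‖ ^ 2) :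
    ∃ 𝒯' ⊆ 𝒯,
      (∀ T ∈ 𝒯', ∀ T' ∈ 𝒯', T ≠ T' → Disjoint (T.top.rect w) (T'.top.rect w)) ∧
      ∑ T ∈ 𝒯, T.top.area w ≤ 441 / c * ∑ T ∈ 𝒯', T.top.area w := by
  obtain ⟨u, hu, hudisj, hucov⟩ := Vitali.exists_disjoint_subfamily_covering_enlargement
    (fun T : Tree => T.top.rect w) (𝒯 : Set Tree) (fun T => (2 : ℝ) ^ T.top.l) (3 / 2)
    (by norm_num) (fun _ _ => by positivity) (∑ T ∈ 𝒯, (2 : ℝ) ^ T.top.l)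
    (fun T hT => Finset.single_le_sum (f := fun T : Tree => (2 : ℝ) ^ T.top.l)
      (fun _ _ => by positivity) hT)
    (fun T _ => T.top.rect_nonempty hw)
  lift u to Finset Tree using 𝒯.finite_toSet.subset hu
  have hu : u ⊆ 𝒯 := Finset.coe_subset.1 hu
  choose! g hgu hgmeet hgl using hucov
  have hω : ∀ T ∈ 𝒯, (g T).top.ω ⊆ T.top.ω := by
    intro T hT
    have hR := R.slope_mem_ω
    refine Tile.ω_subset_ω ?_ ((htree T hT).2.2 hR) ((htree _ (hu (hgu T hT))).2.2 hR)
    by_contra! hlt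
    have h₁ : (2 : ℝ) ^ ((g T).top.l + 1) ≤ 2 ^ T.top.l := pow_le_pow_right₀ (by norm_num) hlt
    have h₂ := hgl T hT
    have h₃ : (0 : ℝ) < 2 ^ (g T).top.l := by positivity
    rw [pow_succ] at h₁
    linarith
  refine ⟨u, hu, fun T hT T' hT' hne => hudisj hT hT' hne, ?_⟩
  rw [← Finset.sum_fiberwise_of_maps_to (s := 𝒯) (t := u) (g := g) hgu, Finset.mul_sum]
  refine Finset.sum_le_sum fun b _ => sum_area_le_of_meet hw hσ hc hsize ?_ ?_ ?_ ?_ ?_ ?_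
  · exact fun T hT => Finset.le_sup (f := Tree.tiles) (Finset.mem_filter.1 hT).1
  · exact fun T hT => (htree T (Finset.mem_filter.1 hT).1).1
  · intro T hT
    obtain ⟨hT, hb⟩ := Finset.mem_filter.1 hT
    exact hb ▸ hω T hT
  · intro T hT
    obtain ⟨hT, hb⟩ := Finset.mem_filter.1 hT
    exact hb ▸ hgmeet T hT
  · exact fun T hT T' hT' =>
      hdisj T (Finset.mem_filter.1 hT).1 T' (Finset.mem_filter.1 hT').1
  · exact fun T hT => hlow T (Finset.mem_filter.1 hT).1

/-- the disjoint tops claim. -/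
theorem disjoint_tops_claim
    (β βt : ℝ → ℝ) (hβ : IsBumpβ β) (hβt : IsBumpβt βt) (cc : ℕ) :
    ∃ C c₁ : ℝ, 0 < C ∧ 0 < c₁ ∧
      ∀ (w : ℝ), 0 < w →
      ∀ (F : Set (ℝ × ℝ)), MeasurableSet F →
      ∀ (σ : ℝ), 0 < σ →
      ∀ (R : Tile) (𝒯 : Finset Tree),
        (∀ T ∈ 𝒯, T.IsTree w ∧ Tile.le w T.top R) →
        (∀ T ∈ 𝒯, ∀ T' ∈ 𝒯, T ≠ T' → Disjoint T.tiles T'.tiles) →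
        size β βt cc w F (𝒯.sup Tree.tiles) ≤ σ →
        (∀ T ∈ 𝒯, c₁ * σ ^ 2 * T.top.area w ≤
            ∑ s ∈ T.oneTiles, ‖inn (F.indicator fun _ => (1:ℂ)) (wp β βt cc w s)‖ ^ 2) →
        ∃ 𝒯' ⊆ 𝒯,
          (∀ T ∈ 𝒯', ∀ T' ∈ 𝒯', T ≠ T' → Disjoint (T.top.rect w) (T'.top.rect w)) ∧
          ∑ T ∈ 𝒯, T.top.area w ≤ C * ∑ T ∈ 𝒯', T.top.area w := by
  refine ⟨441, 1, by norm_num, by norm_num, fun w hw F _ σ hσ R 𝒯 htree hdisj hsize hlow => ?_⟩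
  simpa using exists_disjoint_tops hw hσ one_pos htree hdisj hsize hlow
end Bateman
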